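/- arXiv:1202.6157 — 2 statements merged into one kernel-verified Lean document; each statement's English description precedes it below -/
import Mathlib

section
/- Assume β > K and assume there exists at least one action profile at which all K players are satisfied. Then an action profile a* maximizes the social welfare W over all action profiles if and only if (i) all K players are satisfied at a*, and (ii) a* minimizes the total transmit power Σ_{k=1}^K p_k among all action profiles at which all K players are satisfied. (This identifies the welfare-maximizing profiles selected by trial-and-error learning with the solutions of the paper's global power-minimization problem (2) with K* = K.) -/
open Finset

/-- SINR of player `k` at action profile `a` (each action is a power–channel pair). -/
noncomputable def sinr {K : ℕ} {Ch : Type} [Fintype Ch] [DecidableEq Ch]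
    (g : Fin K → Fin K → Ch → ℝ) (σ2 : ℝ) (a : Fin K → ℝ × Ch) (k : Fin K) : ℝ :=
  (a k).1 * g k k ((a k).2) /
    (σ2 + ∑ l ∈ Finset.univ.filter (fun l => l ≠ k ∧ (a l).2 = (a k).2),
      (a l).1 * g k l ((a k).2))

/-- Utility of player `k`. -/
noncomputable def util {K : ℕ} {Ch : Type} [Fintype Ch] [DecidableEq Ch]
    (g : Fin K → Fin K → Ch → ℝ) (σ2 Γ PMAX β : ℝ) (a : Fin K → ℝ × Ch) (k : Fin K) : ℝ :=
  (1 / (1 + β)) * ((PMAX - (a k).1) / PMAX + β * (if Γ ≤ sinr g σ2 a k then 1 else 0))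

/-- Social welfare: the sum of the individual utilities. -/
noncomputable def welfare {K : ℕ} {Ch : Type} [Fintype Ch] [DecidableEq Ch]
    (g : Fin K → Fin K → Ch → ℝ) (σ2 Γ PMAX β : ℝ) (a : Fin K → ℝ × Ch) : ℝ :=
  ∑ k, util g σ2 Γ PMAX β a k

/-- Welfare as a function of the total power and the number of satisfied players. -/
theorem welfare_eq {K : ℕ} {Ch : Type} [Fintype Ch] [DecidableEq Ch]
    (g : Fin K → Fin K → Ch → ℝ) (σ2 Γ β : ℝ) {PMAX : ℝ} (hP : 0 < PMAX)
    (a : Fin K → ℝ × Ch) :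
    welfare g σ2 Γ PMAX β a = (1 / (1 + β)) *
      (K - (∑ k, (a k).1) / PMAX + β * ∑ k, (if Γ ≤ sinr g σ2 a k then 1 else 0 : ℝ)) := by
  simp only [welfare, util, ← Finset.mul_sum, Finset.sum_add_distrib, ← Finset.sum_div,
    Finset.sum_sub_distrib, Finset.sum_const, Finset.card_univ, Fintype.card_fin, nsmul_eq_mul]
  rw [sub_div, mul_div_cancel_right₀ _ hP.ne']

/-- If some index fails `p`, the sum of the indicators of `p` is at most the cardinality minus
one. -/
theorem sum_indicator_le_sub_one {K : ℕ} (p : Fin K → Prop) [DecidablePred p] {i : Fin K}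
    (hi : ¬ p i) : ∑ k, (if p k then 1 else 0 : ℝ) ≤ K - 1 := by
  have h : ∑ k, (if p k then 1 else 0 : ℝ) ≤ ∑ k, (1 - if k = i then 1 else 0 : ℝ) := by
    refine Finset.sum_le_sum fun k _ => ?_
    by_cases hk : k = i
    · subst hk
      simp [hi]
    · simp only [hk, if_false]
      split_ifs <;> norm_num
  simpa using h

/-- with `β > K` and assuming some profile satisfies all players, a profile
maximizes the social welfare iff it satisfies all players and minimizes the total transmit
power among all fully-satisfied profiles. -/
theorem stmt2
    (K : ℕ) (hK : 1 ≤ K)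
    (Ch : Type) [Fintype Ch] [DecidableEq Ch]
    (Pow : Finset ℝ) (hPow0 : (0 : ℝ) ∈ Pow) (hPownn : ∀ x ∈ Pow, 0 ≤ x)
    (PMAX : ℝ) (hPmem : PMAX ∈ Pow) (hPub : ∀ x ∈ Pow, x ≤ PMAX) (hPpos : 0 < PMAX)
    (g : Fin K → Fin K → Ch → ℝ) (hg : ∀ k l b, 0 ≤ g k l b) (hgd : ∀ k b, 0 < g k k b)
    (σ2 : ℝ) (hσ : 0 < σ2) (Γ : ℝ) (hΓ : 0 < Γ)
    (β : ℝ) (hβ : (K : ℝ) < β)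
    (hfeas : ∃ a : Fin K → ℝ × Ch, (∀ k, (a k).1 ∈ Pow) ∧ ∀ k, Γ ≤ sinr g σ2 a k)
    (astar : Fin K → ℝ × Ch) (hastar : ∀ k, (astar k).1 ∈ Pow) :
    (∀ a : Fin K → ℝ × Ch, (∀ k, (a k).1 ∈ Pow) →
        welfare g σ2 Γ PMAX β a ≤ welfare g σ2 Γ PMAX β astar) ↔
      ((∀ k, Γ ≤ sinr g σ2 astar k) ∧
        ∀ a : Fin K → ℝ × Ch, (∀ k, (a k).1 ∈ Pow) → (∀ k, Γ ≤ sinr g σ2 a k) →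
          ∑ k, (astar k).1 ≤ ∑ k, (a k).1) := by
  have hK0 : (0 : ℝ) ≤ K := Nat.cast_nonneg K
  have hc : 0 < 1 / (1 + β) := one_div_pos.mpr (by linarith)
  have hall : ∀ a : Fin K → ℝ × Ch, (∀ k, Γ ≤ sinr g σ2 a k) →
      ∑ k, (if Γ ≤ sinr g σ2 a k then 1 else 0 : ℝ) = K := fun a ha => by simp [ha]
  have hpow_nonneg : ∀ a : Fin K → ℝ × Ch, (∀ k, (a k).1 ∈ Pow) →
      0 ≤ (∑ k, (a k).1) / PMAX := fun a ha =>
    div_nonneg (Finset.sum_nonneg fun k _ => hPownn _ (ha k)) hPpos.le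
  have hpow_le : ∀ a : Fin K → ℝ × Ch, (∀ k, (a k).1 ∈ Pow) →
      (∑ k, (a k).1) / PMAX ≤ K := fun a ha => by
    rw [div_le_iff₀ hPpos]
    simpa using Finset.sum_le_sum fun k (_ : k ∈ Finset.univ) => hPub _ (ha k)
  have hlt : ∀ a b : Fin K → ℝ × Ch, (∀ k, (a k).1 ∈ Pow) → (∀ k, (b k).1 ∈ Pow) →
      (∀ k, Γ ≤ sinr g σ2 b k) → (¬ ∀ k, Γ ≤ sinr g σ2 a k) →
      welfare g σ2 Γ PMAX β a < welfare g σ2 Γ PMAX β b := by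
    intro a b ha hb hbs has
    obtain ⟨i, hi⟩ := not_forall.mp has
    have hN := mul_le_mul_of_nonneg_left
      (sum_indicator_le_sub_one (fun k => Γ ≤ sinr g σ2 a k) hi) (hK0.trans hβ.le)
    rw [welfare_eq g σ2 Γ β hPpos, welfare_eq g σ2 Γ β hPpos, hall b hbs]
    refine mul_lt_mul_of_pos_left ?_ hc
    linarith [hpow_nonneg a ha, hpow_le b hb]
  have hle : ∀ a b : Fin K → ℝ × Ch, (∀ k, Γ ≤ sinr g σ2 a k) → (∀ k, Γ ≤ sinr g σ2 b k) →
      (welfare g σ2 Γ PMAX β a ≤ welfare g σ2 Γ PMAX β b ↔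
        ∑ k, (b k).1 ≤ ∑ k, (a k).1) := by
    intro a b has hbs
    rw [welfare_eq g σ2 Γ β hPpos, welfare_eq g σ2 Γ β hPpos, hall a has, hall b hbs,
      mul_le_mul_iff_right₀ hc, add_le_add_iff_right, sub_le_sub_iff_left,
      div_le_div_iff_of_pos_right hPpos]
  obtain ⟨b, hb, hbs⟩ := hfeas
  constructor
  · intro hmax
    have hsat : ∀ k, Γ ≤ sinr g σ2 astar k := by
      by_contra hns
      exact (hmax b hb).not_gt (hlt astar b hastar hb hbs hns)
    exact ⟨hsat, fun a ha has => (hle a astar has hsat).mp (hmax a ha)⟩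
  · rintro ⟨hsat, hmin⟩ a ha
    by_cases has : ∀ k, Γ ≤ sinr g σ2 a k
    · exact (hle a astar has hsat).mpr (hmin a ha has)
    · exact (hlt a astar ha hastar hsat has).le
end

section
/- Assume β > K. If a* maximizes the social welfare W over all action profiles, then a* satisfies the maximum possible number of players: S(a*) = max over all action profiles a of S(a). (Content of the paper's Theorem 3: with β > K, trial-and-error learning, which selects welfare-maximizing equilibria, satisfies the largest possible set of players.) -/
open Finset

/-- Number of satisfied players at profile `a`. -/
noncomputable def numSat {K : ℕ} {Ch : Type} [Fintype Ch] [DecidableEq Ch]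
    (g : Fin K → Fin K → Ch → ℝ) (σ2 Γ : ℝ) (a : Fin K → ℝ × Ch) : ℕ :=
  (Finset.univ.filter (fun k => Γ ≤ sinr g σ2 a k)).card

/-- Welfare is, up to a positive factor, the total normalized power saving plus `β` times the number
of satisfied players. -/
theorem welfare_eq_saving_add_numSat {K : ℕ} {Ch : Type} [Fintype Ch] [DecidableEq Ch]
    (g : Fin K → Fin K → Ch → ℝ) (σ2 Γ PMAX β : ℝ) (a : Fin K → ℝ × Ch) :
    welfare g σ2 Γ PMAX β a =
      (1 / (1 + β)) * (∑ k, (PMAX - (a k).1) / PMAX + β * numSat g σ2 Γ a) := by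
  simp only [welfare, util, numSat, ← Finset.mul_sum, Finset.sum_add_distrib, Finset.sum_boole]

/-- The total normalized power saving is nonnegative when no power exceeds `PMAX`. -/
theorem saving_nonneg {K : ℕ} {Ch : Type} {PMAX : ℝ} (hP : 0 < PMAX)
    (a : Fin K → ℝ × Ch) (ha : ∀ k, (a k).1 ≤ PMAX) :
    0 ≤ ∑ k, (PMAX - (a k).1) / PMAX :=
  Finset.sum_nonneg fun k _ => div_nonneg (sub_nonneg.2 (ha k)) hP.le

/-- The total normalized power saving is at most the number of players when powers are
nonnegative. -/
theorem saving_le_card {K : ℕ} {Ch : Type} {PMAX : ℝ} (hP : 0 < PMAX)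
    (a : Fin K → ℝ × Ch) (ha : ∀ k, 0 ≤ (a k).1) :
    ∑ k, (PMAX - (a k).1) / PMAX ≤ K := by
  have h : ∑ k, (PMAX - (a k).1) / PMAX ≤ ∑ _k : Fin K, (1 : ℝ) :=
    Finset.sum_le_sum fun k _ => (div_le_one hP).2 (sub_le_self _ (ha k))
  simpa using h

/-- with `β > K`, a welfare-maximizing profile satisfies the maximum possible
number of players. -/
theorem stmt10
    (K : ℕ) (hK : 1 ≤ K)
    (Ch : Type) [Fintype Ch] [DecidableEq Ch]
    (Pow : Finset ℝ) (hPow0 : (0 : ℝ) ∈ Pow) (hPownn : ∀ x ∈ Pow, 0 ≤ x)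
    (PMAX : ℝ) (hPmem : PMAX ∈ Pow) (hPub : ∀ x ∈ Pow, x ≤ PMAX) (hPpos : 0 < PMAX)
    (g : Fin K → Fin K → Ch → ℝ) (hg : ∀ k l b, 0 ≤ g k l b) (hgd : ∀ k b, 0 < g k k b)
    (σ2 : ℝ) (hσ : 0 < σ2) (Γ : ℝ) (hΓ : 0 < Γ)
    (β : ℝ) (hβ : (K : ℝ) < β)
    (astar : Fin K → ℝ × Ch) (hastar : ∀ k, (astar k).1 ∈ Pow)
    (hmax : ∀ a : Fin K → ℝ × Ch, (∀ k, (a k).1 ∈ Pow) →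
      welfare g σ2 Γ PMAX β a ≤ welfare g σ2 Γ PMAX β astar) :
    ∀ a : Fin K → ℝ × Ch, (∀ k, (a k).1 ∈ Pow) →
      numSat g σ2 Γ a ≤ numSat g σ2 Γ astar := by
  intro a ha
  by_contra! hlt
  have hβ0 : 0 < β := (Nat.cast_nonneg K).trans_lt hβ
  have hw := hmax a ha
  rw [welfare_eq_saving_add_numSat, welfare_eq_saving_add_numSat,
    mul_le_mul_iff_right₀ (by positivity)] at hw
  have hlow := saving_nonneg hPpos a fun k => hPub _ (ha k)
  have hupp := saving_le_card hPpos astar fun k => hPownn _ (hastar k)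
  have hS : (numSat g σ2 Γ astar : ℝ) + 1 ≤ numSat g σ2 Γ a := by exact_mod_cast hlt
  have := mul_le_mul_of_nonneg_left hS hβ0.le
  linarith
end
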